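/- Let n ≥ 1, Δ = 2^n, and d ≥ 1. Let M = H⊗H⊗…⊗H be the d-fold Kronecker product of the Δ×Δ Haar matrix with itself. For any d-dimensional rectangular range [l₁,u₁)×…×[l_d,u_d) with 0 ≤ l_t < u_t ≤ Δ for each t, the vector M·(𝟙_{[l₁,u₁)} ⊗ … ⊗ 𝟙_{[l_d,u_d)}) has at most (2n+2)^d nonzero entries. -/

import Mathlib

open Matrix

/-- The scale of the Haar row index `i`: row `0` is the special row of scale `-1`;
row `i ≥ 1` corresponds to the pair `(m, j)` with `m = ⌊log₂ i⌋` and `j = i - 2^m`. -/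
def haarScale (i : ℕ) : ℤ := if i = 0 then -1 else (Nat.log 2 i : ℤ)

/-- Entry of the `2^n × 2^n` Haar matrix, with rows indexed by `i ∈ [0, 2^n)` via the
standard bijection `i = 0 ↔ (m, j) = (-1, 0)` and `i = 2^m + j ↔ (m, j)` for `m ≥ 0`,
`0 ≤ j < 2^m`.  The row `(-1, 0)` is constant `Δ^{-1/2}`; the row `(m, j)` with `m ≥ 0`
takes the value `√(2^m/Δ)` on `[jΔ/2^m, jΔ/2^m + Δ/2^(m+1))`, the value `-√(2^m/Δ)` on
`[jΔ/2^m + Δ/2^(m+1), (j+1)Δ/2^m)`, and `0` elsewhere, where `Δ = 2^n`. -/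
noncomputable def haarEntry (n : ℕ) (i c : ℕ) : ℝ :=
  if i = 0 then (Real.sqrt (2 ^ n))⁻¹
  else
    let m := Nat.log 2 i
    let j := i - 2 ^ m
    if j * (2 ^ n / 2 ^ m) ≤ c ∧ c < j * (2 ^ n / 2 ^ m) + 2 ^ n / 2 ^ (m + 1) then
      Real.sqrt ((2 ^ m : ℝ) / 2 ^ n)
    else if j * (2 ^ n / 2 ^ m) + 2 ^ n / 2 ^ (m + 1) ≤ c ∧ c < (j + 1) * (2 ^ n / 2 ^ m) then
      -Real.sqrt ((2 ^ m : ℝ) / 2 ^ n)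
    else 0

/-- The `2^n × 2^n` Haar matrix. -/
noncomputable def haarMatrix (n : ℕ) : Matrix (Fin (2 ^ n)) (Fin (2 ^ n)) ℝ :=
  Matrix.of fun i c => haarEntry n i.val c.val

/-- The indicator vector of the range `[l, u)` in the universe `[0, Δ)`. -/
def indVec (Δ l u : ℕ) : Fin Δ → ℝ := fun c => if l ≤ (c : ℕ) ∧ (c : ℕ) < u then 1 else 0

/-- A Haar row whose support `[jΔ/2^m, (j+1)Δ/2^m)` contains neither `l` nor `u`
is orthogonal to the indicator vector of `[l, u)`. -/
theorem haarMatrix_mulVec_indVec_eq_zero {n l u : ℕ} (i : Fin (2 ^ n)) (hi : (i : ℕ) ≠ 0)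
    (hl : l / (2 ^ n / 2 ^ Nat.log 2 i) ≠ i - 2 ^ Nat.log 2 i)
    (hu : u / (2 ^ n / 2 ^ Nat.log 2 i) ≠ i - 2 ^ Nat.log 2 i) (hun : u ≤ 2 ^ n) :
    (haarMatrix n *ᵥ indVec (2 ^ n) l u) i = 0 := by
  obtain ⟨i, hin⟩ := i
  dsimp only at hi hl hu
  have hm : Nat.log 2 i < n := Nat.log_lt_of_lt_pow hi hin
  set m := Nat.log 2 i with hmdef
  set j := i - 2 ^ m with hj
  have hL : 2 ^ n / 2 ^ m = 2 * 2 ^ (n - m - 1) := by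
    rw [Nat.pow_div hm.le two_pos, ← pow_succ']
    congr 1
    omega
  have hh : 2 ^ n / 2 ^ (m + 1) = 2 ^ (n - m - 1) := by
    rw [Nat.pow_div hm two_pos]
    congr 1
  have hpos : 0 < 2 ^ (n - m - 1) := by positivity
  rw [hL] at hl hu
  set h := 2 ^ (n - m - 1)
  set a := Real.sqrt ((2 ^ m : ℝ) / 2 ^ n) with ha
  have key (c : ℕ) : haarEntry n i c =
      (if c ∈ Finset.Ico (j * (2 * h)) (j * (2 * h) + h) then a else 0) -
        (if c ∈ Finset.Ico (j * (2 * h) + h) (j * (2 * h) + 2 * h) then a else 0) := by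
    simp only [haarEntry, hi, if_false, ← hmdef, ← hj, hL, hh, ← ha, Finset.mem_Ico, add_one_mul]
    split_ifs <;> first | omega | simp
  have hsum : (haarMatrix n *ᵥ indVec (2 ^ n) l u) ⟨i, hin⟩ =
      ∑ c ∈ Finset.range (2 ^ n), haarEntry n i c * (if l ≤ c ∧ c < u then 1 else 0) := by
    rw [← Fin.sum_univ_eq_sum_range
      (fun c => haarEntry n i c * (if l ≤ c ∧ c < u then 1 else 0))]
    rfl
  rw [hsum]
  by_cases hin' : l ≤ j * (2 * h) ∧ j * (2 * h) + 2 * h ≤ u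
  · have hterm (c : ℕ) : haarEntry n i c * (if l ≤ c ∧ c < u then 1 else 0) =
        haarEntry n i c := by
      rw [key]
      simp only [Finset.mem_Ico]
      split_ifs <;> first | omega | simp
    simp_rw [hterm, key, Finset.sum_sub_distrib, Finset.sum_ite_mem, Finset.sum_const]
    rw [Finset.inter_eq_right.2, Finset.inter_eq_right.2, Nat.card_Ico, Nat.card_Ico, sub_eq_zero]
    · congr 1
      omega
    all_goals
      intro c
      simp only [Finset.mem_Ico, Finset.mem_range]
      omega
  · refine Finset.sum_eq_zero fun c _ => ?_
    have hout : ¬ (l ≤ c ∧ c < u ∧ j * (2 * h) ≤ c ∧ c < j * (2 * h) + 2 * h) := by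
      rintro ⟨h1, h2, h3, h4⟩
      refine hin' ⟨?_, ?_⟩
      · by_contra hlt
        exact hl (Nat.div_eq_of_lt_le (by omega) (by rw [add_one_mul]; omega))
      · by_contra hlt
        exact hu (Nat.div_eq_of_lt_le (by omega) (by rw [add_one_mul]; omega))
    rw [key]
    simp only [Finset.mem_Ico]
    split_ifs <;> first | omega | simp

theorem haarMatrix_indVec_nonzero_card_le (n l u : ℕ) (hu : u ≤ 2 ^ n) :
    (Finset.univ.filter fun i => (haarMatrix n *ᵥ indVec (2 ^ n) l u) i ≠ 0).card
      ≤ 2 * n + 1 := by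
  let row (x m : ℕ) : ℕ := 2 ^ m + x / (2 ^ n / 2 ^ m)
  calc
    _ ≤ (insert 0 ((Finset.range n).image (row l) ∪ (Finset.range n).image (row u))).card := by
      refine Finset.card_le_card_of_injOn Fin.val (fun i hi => ?_) Fin.val_injective.injOn
      have hne : (haarMatrix n *ᵥ indVec (2 ^ n) l u) i ≠ 0 := by simpa using hi
      simp only [Finset.coe_insert, Finset.coe_union, Finset.coe_image, Finset.coe_range,
        Set.mem_insert_iff, Set.mem_union, Set.mem_image, Set.mem_Iio]
      by_contra! hcon
      obtain ⟨h0, hl, hu'⟩ := hcon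
      have hm : Nat.log 2 i < n := Nat.log_lt_of_lt_pow h0 i.isLt
      have hpow := Nat.pow_log_le_self 2 h0
      have hlrow := hl _ hm
      have hurow := hu' _ hm
      simp only [row] at hlrow hurow
      exact hne (haarMatrix_mulVec_indVec_eq_zero i h0 (by omega) (by omega) hu)
    _ ≤ ((Finset.range n).card + (Finset.range n).card) + 1 :=
      (Finset.card_insert_le _ _).trans <| Nat.add_le_add_right
        ((Finset.card_union_le _ _).trans
          (Nat.add_le_add Finset.card_image_le Finset.card_image_le)) 1
    _ = 2 * n + 1 := by rw [Finset.card_range]; ring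

/-- A Kronecker power applied to a product vector is the product of the factors. -/
theorem mulVec_prod_eq_prod_mulVec {ι κ R : Type*} [Fintype ι] [DecidableEq ι] [Fintype κ]
    [CommSemiring R] (A : Matrix κ κ R) (v : ι → κ → R) (i : ι → κ) :
    ((Matrix.of fun r c : ι → κ => ∏ t, A (r t) (c t)) *ᵥ fun c => ∏ t, v t (c t)) i =
      ∏ t, (A *ᵥ v t) (i t) := by
  simp only [mulVec, dotProduct, of_apply, ← Finset.prod_mul_distrib]
  exact (Fintype.prod_sum fun t c => A (i t) c * v t c).symm

/-- For `n ≥ 1`, `Δ = 2^n`, `d ≥ 1`, let `M = H ⊗ ⋯ ⊗ H` be the `d`-fold Kronecker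
product of the Haar matrix with itself (with rows and columns indexed by `d`-tuples,
so that `M r c = ∏ₜ H (r t) (c t)`).  For any `d`-dimensional rectangular range
`[l₁,u₁) × ⋯ × [l_d,u_d)` with `0 ≤ lₜ < uₜ ≤ Δ`, the vector
`M · (𝟙_{[l₁,u₁)} ⊗ ⋯ ⊗ 𝟙_{[l_d,u_d)})` has at most `(2n+2)^d` nonzero entries. -/
theorem haarD_indicator_nonzero_card_le (n d : ℕ) (hn : 1 ≤ n) (hd : 1 ≤ d)
    (l u : Fin d → ℕ) (hlu : ∀ t, l t < u t) (hu : ∀ t, u t ≤ 2 ^ n) :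
    (Finset.univ.filter fun i : Fin d → Fin (2 ^ n) =>
      Matrix.mulVec (Matrix.of fun r c : Fin d → Fin (2 ^ n) => ∏ t, haarMatrix n (r t) (c t))
        (fun c => ∏ t, indVec (2 ^ n) (l t) (u t) (c t)) i ≠ 0).card
      ≤ (2 * n + 2) ^ d := by
  simp_rw [mulVec_prod_eq_prod_mulVec (haarMatrix n) (fun t => indVec (2 ^ n) (l t) (u t))]
  calc
    _ ≤ (Fintype.piFinset fun t => Finset.univ.filter fun i =>
          (haarMatrix n *ᵥ indVec (2 ^ n) (l t) (u t)) i ≠ 0).card := by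
      refine Finset.card_le_card fun i hi => ?_
      simpa [Finset.prod_ne_zero_iff] using hi
    _ ≤ ∏ _t : Fin d, (2 * n + 2) := by
      rw [Fintype.card_piFinset]
      exact Finset.prod_le_prod' fun t _ =>
        (haarMatrix_indVec_nonzero_card_le n (l t) (u t) (hu t)).trans (Nat.le_succ _)
    _ = (2 * n + 2) ^ d := by simp
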